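/- Transition-maximal NFAs are locally-saturated and intersection-saturated: let N be a relational NFA over Σ with L := L(N) that is transition-maximal (its only extension is itself, where an extension is an NFA M on the same state set with I_N ⊆ I_M, F_N ⊆ F_M, N_a ⊆ M_a for all letters a, and L(M) = L(N)). Then (a) N is locally-saturated: for every state z, z ∈ I_N ↔ L(N_{@z}) ⊆ L, and for every letter a and states z₁, z₂, (z₁,z₂) ∈ N_a ↔ L(N_{@z₂}) ⊆ a⁻¹L(N_{@z₁}); and (b) N is intersection-saturated: for every letter a and states z₁, z₂, (z₁,z₂) ∈ N_a ↔ (∀ words u: z₁ ∈ N_u[I_N] → z₂ ∈ N_{u++[a]}[I_N]), and for every state z, z ∈ F_N ↔ (∀ words u: z ∈ N_u[I_N] → N_u[I_N] ∩ F_N ≠ ∅). -/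

import Mathlib

/-- A relational nondeterministic finite automaton over alphabet `σ` with states `Z`. -/
structure RelNFA (σ : Type*) (Z : Type*) where
  /-- initial states -/
  I : Set Z
  /-- final states -/
  F : Set Z
  /-- for each letter, a transition relation -/
  tr : σ → Z → Z → Prop

namespace RelNFA

variable {σ Z : Type*}

/-- `N_w`: the transition relation of the word `w`, with `N_ε` the identity
relation and `N_{u·a} = N_u ; N_a`. -/
def runRel (N : RelNFA σ Z) (w : List σ) : Z → Z → Prop :=
  w.foldl (fun R a => fun z z' => ∃ y, R z y ∧ N.tr a y z') Eq

/-- `N_w[S]`: the relational image of a set of states. -/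
def imgSet (N : RelNFA σ Z) (w : List σ) (S : Set Z) : Set Z :=
  {z' | ∃ z ∈ S, N.runRel w z z'}

/-- The language accepted by `N`: `{w : N_w[I] ∩ F ≠ ∅}`. -/
def lang (N : RelNFA σ Z) : Set (List σ) :=
  {w | (N.imgSet w N.I ∩ N.F).Nonempty}

/-- `L(N_{@z})`: the language accepted by `N` with initial states `{z}`. -/
def langFrom (N : RelNFA σ Z) (z : Z) : Set (List σ) :=
  {w | (N.imgSet w {z} ∩ N.F).Nonempty}

/-- The reverse nfa: swap initial and final states and take converse transitions. -/
def rev (N : RelNFA σ Z) : RelNFA σ Z where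
  I := N.F
  F := N.I
  tr := fun a z z' => N.tr a z' z

end RelNFA

/-- Left quotient of a language by a single letter: `a⁻¹X = {w : [a]++w ∈ X}`. -/
def letterQuot {σ : Type*} (a : σ) (X : Set (List σ)) : Set (List σ) :=
  {w | a :: w ∈ X}

/-- `M` extends `N`: same state set, more initial/final states and transitions,
same accepted language. -/
def ExtendsNFA {σ Z : Type*} (M N : RelNFA σ Z) : Prop :=
  N.I ⊆ M.I ∧ N.F ⊆ M.F ∧ (∀ (a : σ) (z z' : Z), N.tr a z z' → M.tr a z z') ∧
    M.lang = N.lang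

/-- An nfa is transition-maximal if its only extension is itself. -/
def TransitionMaximal {σ Z : Type*} (N : RelNFA σ Z) : Prop :=
  ∀ M : RelNFA σ Z, ExtendsNFA M N → M = N

/-- An nfa is locally-saturated when initial states and transitions are as large
as the languages of the individual states permit. -/
def LocallySaturated {σ Z : Type*} (N : RelNFA σ Z) : Prop :=
  (∀ z : Z, z ∈ N.I ↔ N.langFrom z ⊆ N.lang) ∧
  (∀ (a : σ) (z₁ z₂ : Z), N.tr a z₁ z₂ ↔ N.langFrom z₂ ⊆ letterQuot a (N.langFrom z₁))

/-- An nfa is intersection-saturated when its transitions and final states are as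
large as the reachable subsets permit (Kameda–Weiner's intersection rule). -/
def IntersectionSaturated {σ Z : Type*} (N : RelNFA σ Z) : Prop :=
  (∀ (a : σ) (z₁ z₂ : Z), N.tr a z₁ z₂ ↔
    ∀ u : List σ, z₁ ∈ N.imgSet u N.I → z₂ ∈ N.imgSet (u ++ [a]) N.I) ∧
  (∀ z : Z, z ∈ N.F ↔
    ∀ u : List σ, z ∈ N.imgSet u N.I → (N.imgSet u N.I ∩ N.F).Nonempty)

namespace RelNFA

variable {σ Z : Type*}

theorem runRel_nil (N : RelNFA σ Z) (z z' : Z) : N.runRel [] z z' ↔ z = z' :=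
  Iff.rfl

theorem runRel_append_singleton (N : RelNFA σ Z) (w : List σ) (a : σ) (z z' : Z) :
    N.runRel (w ++ [a]) z z' ↔ ∃ y, N.runRel w z y ∧ N.tr a y z' := by
  simp [runRel]

theorem runRel_cons (N : RelNFA σ Z) (a : σ) (w : List σ) (z z' : Z) :
    N.runRel (a :: w) z z' ↔ ∃ y, N.tr a z y ∧ N.runRel w y z' := by
  induction w using List.reverseRecOn generalizing z' with
  | nil => simpa [runRel_nil] using N.runRel_append_singleton [] a z z'
  | append_singleton w b ih =>
    rw [← List.cons_append]
    simp only [runRel_append_singleton, ih]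
    constructor
    · rintro ⟨y, ⟨x, hx, hxy⟩, hy⟩
      exact ⟨x, hx, y, hxy, hy⟩
    · rintro ⟨x, hx, y, hxy, hy⟩
      exact ⟨y, ⟨x, hx, hxy⟩, hy⟩

theorem runRel_mono {M N : RelNFA σ Z} (h : ∀ a z z', N.tr a z z' → M.tr a z z')
    (w : List σ) {z z' : Z} (hw : N.runRel w z z') : M.runRel w z z' := by
  induction w generalizing z with
  | nil => exact hw
  | cons a w ih =>
    rw [runRel_cons] at hw ⊢
    obtain ⟨y, hy, hyz⟩ := hw
    exact ⟨y, h a z y hy, ih hyz⟩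

theorem mem_langFrom (N : RelNFA σ Z) (z : Z) (w : List σ) :
    w ∈ N.langFrom z ↔ ∃ z' ∈ N.F, N.runRel w z z' := by
  simp [langFrom, imgSet, Set.Nonempty, and_comm]

theorem mem_lang (N : RelNFA σ Z) (w : List σ) :
    w ∈ N.lang ↔ ∃ z ∈ N.I, w ∈ N.langFrom z := by
  simp only [mem_langFrom]
  constructor
  · rintro ⟨z', ⟨z, hz, hw⟩, hF⟩
    exact ⟨z, hz, z', hF, hw⟩
  · rintro ⟨z, hz, z', hF, hw⟩
    exact ⟨z', ⟨z, hz, hw⟩, hF⟩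

theorem mem_langFrom_cons (N : RelNFA σ Z) (z : Z) (a : σ) (w : List σ) :
    a :: w ∈ N.langFrom z ↔ ∃ y, N.tr a z y ∧ w ∈ N.langFrom y := by
  simp only [mem_langFrom, runRel_cons]
  constructor
  · rintro ⟨z', hF, y, hy, hw⟩
    exact ⟨y, hy, z', hF, hw⟩
  · rintro ⟨y, hy, z', hF, hw⟩
    exact ⟨z', hF, y, hy, hw⟩

theorem mem_imgSet_append_singleton (N : RelNFA σ Z) (w : List σ) (a : σ) (S : Set Z) (z' : Z) :
    z' ∈ N.imgSet (w ++ [a]) S ↔ ∃ y ∈ N.imgSet w S, N.tr a y z' := by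
  simp only [imgSet, Set.mem_ofPred_eq, runRel_append_singleton]
  constructor
  · rintro ⟨z, hz, y, hy, hyz⟩
    exact ⟨y, ⟨z, hz, hy⟩, hyz⟩
  · rintro ⟨y, ⟨z, hz, hy⟩, hyz⟩
    exact ⟨z, hz, y, hy, hyz⟩

theorem lang_mono {M N : RelNFA σ Z} (hI : N.I ⊆ M.I) (hF : N.F ⊆ M.F)
    (ht : ∀ a z z', N.tr a z z' → M.tr a z z') : N.lang ⊆ M.lang := by
  rintro w ⟨z', ⟨z, hz, hw⟩, hz'⟩
  exact ⟨z', ⟨z, hI hz, runRel_mono ht w hw⟩, hF hz'⟩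

/-- The local saturation of `N`: all initial states and transitions permitted by the languages of
the individual states. -/
def localSaturation (N : RelNFA σ Z) : RelNFA σ Z where
  I := {z | N.langFrom z ⊆ N.lang}
  F := N.F
  tr := fun a z₁ z₂ => N.langFrom z₂ ⊆ letterQuot a (N.langFrom z₁)

theorem langFrom_localSaturation_subset (N : RelNFA σ Z) (z : Z) :
    N.localSaturation.langFrom z ⊆ N.langFrom z := by
  intro w hw
  induction w generalizing z with
  | nil =>
    rw [mem_langFrom] at hw ⊢
    exact hw
  | cons a w ih =>
    obtain ⟨y, hy, hw⟩ := (mem_langFrom_cons _ _ _ _).1 hw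
    exact hy (ih y hw)

theorem extendsNFA_localSaturation (N : RelNFA σ Z) : ExtendsNFA N.localSaturation N := by
  have hI : N.I ⊆ N.localSaturation.I := fun z hz w hw => (N.mem_lang w).2 ⟨z, hz, hw⟩
  have ht : ∀ a z z', N.tr a z z' → N.localSaturation.tr a z z' :=
    fun a z z' h w hw => (N.mem_langFrom_cons z a w).2 ⟨z', h, hw⟩
  refine ⟨hI, subset_rfl, ht, Set.Subset.antisymm ?_ (lang_mono hI subset_rfl ht)⟩
  intro w hw
  obtain ⟨z, hz, hw⟩ := (mem_lang _ _).1 hw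
  exact hz (N.langFrom_localSaturation_subset z hw)

/-- The intersection saturation of `N`: all transitions and final states permitted by the
reachable subsets. -/
def intersectionSaturation (N : RelNFA σ Z) : RelNFA σ Z where
  I := N.I
  F := {z | ∀ u : List σ, z ∈ N.imgSet u N.I → (N.imgSet u N.I ∩ N.F).Nonempty}
  tr := fun a z₁ z₂ => ∀ u : List σ, z₁ ∈ N.imgSet u N.I → z₂ ∈ N.imgSet (u ++ [a]) N.I

theorem imgSet_intersectionSaturation_subset (N : RelNFA σ Z) (u : List σ) :
    N.intersectionSaturation.imgSet u N.I ⊆ N.imgSet u N.I := by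
  induction u using List.reverseRecOn with
  | nil => exact subset_rfl
  | append_singleton u a ih =>
    intro z hz
    obtain ⟨y, hy, hyz⟩ := (mem_imgSet_append_singleton _ _ _ _ _).1 hz
    exact hyz u (ih hy)

theorem extendsNFA_intersectionSaturation (N : RelNFA σ Z) :
    ExtendsNFA N.intersectionSaturation N := by
  have hF : N.F ⊆ N.intersectionSaturation.F := fun z hz _ hu => ⟨z, hu, hz⟩
  have ht : ∀ a z z', N.tr a z z' → N.intersectionSaturation.tr a z z' :=
    fun a z z' h u hu => (N.mem_imgSet_append_singleton u a N.I z').2 ⟨z, hu, h⟩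
  refine ⟨subset_rfl, hF, ht, Set.Subset.antisymm ?_ (lang_mono subset_rfl hF ht)⟩
  rintro w ⟨z, hz, hzF⟩
  exact hzF w (N.imgSet_intersectionSaturation_subset w hz)

end RelNFA

/-- Transition-maximal nfas are locally-saturated and intersection-saturated. -/
theorem transitionMaximal_locallySaturated_and_intersectionSaturated
    {σ Z : Type*} (N : RelNFA σ Z) (h : TransitionMaximal N) :
    LocallySaturated N ∧ IntersectionSaturated N := by
  have hl := h _ N.extendsNFA_localSaturation
  have hi := h _ N.extendsNFA_intersectionSaturation
  refine ⟨⟨fun z => ?_, fun a z₁ z₂ => ?_⟩, fun a z₁ z₂ => ?_, fun z => ?_⟩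
  · exact iff_of_eq (congrArg (fun M : RelNFA σ Z => z ∈ M.I) hl.symm)
  · exact iff_of_eq (congrArg (fun M : RelNFA σ Z => M.tr a z₁ z₂) hl.symm)
  · exact iff_of_eq (congrArg (fun M : RelNFA σ Z => M.tr a z₁ z₂) hi.symm)
  · exact iff_of_eq (congrArg (fun M : RelNFA σ Z => z ∈ M.F) hi.symm)
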